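/- For α ∈ ℂ, the product on ℂ⁴ (basis x, y, h, z) defined by the left-multiplication matrices of the family A_{2,α}: L(x) = [[0,0,−1,1+α],[0,0,0,0],[0,(1+α)/2,0,0],[0,1/2,0,0]], L(y) = [[0,0,0,0],[0,0,1,1−α],[(α−1)/2,0,0,0],[1/2,0,0,0]], L(h) = [[1,0,0,0],[0,−1,0,0],[0,0,α,1−α²],[0,0,1,−α]], L(z) = [[1+α,0,0,0],[0,1−α,0,0],[0,0,1−α²,α³−α],[0,0,−α,1+α²]] is left-symmetric: (a·b)·c − a·(b·c) = (b·a)·c − b·(a·c) for all a, b, c. -/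

import Mathlib

/-- Left-multiplication matrices of the family `A_{2,α}` on `ℂ⁴` with basis
`(x, y, h, z)` (columns indexed by the basis). -/
noncomputable def L2 (α : ℂ) : Fin 4 → Matrix (Fin 4) (Fin 4) ℂ :=
  ![!![0, 0, -1, 1 + α; 0, 0, 0, 0; 0, (1 + α)/2, 0, 0; 0, 1/2, 0, 0],
    !![0, 0, 0, 0; 0, 0, 1, 1 - α; (α - 1)/2, 0, 0, 0; 1/2, 0, 0, 0],
    !![1, 0, 0, 0; 0, -1, 0, 0; 0, 0, α, 1 - α^2; 0, 0, 1, -α],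
    !![1 + α, 0, 0, 0; 0, 1 - α, 0, 0; 0, 0, 1 - α^2, α^3 - α; 0, 0, -α, 1 + α^2]]

/-- The bilinear product of `A_{2,α}` on `ℂ⁴` determined by `L2 α`. -/
noncomputable def mul2 (α : ℂ) (a b : Fin 4 → ℂ) : Fin 4 → ℂ :=
  ∑ i : Fin 4, a i • (L2 α i).mulVec b

/-- For every `α ∈ ℂ` the algebra `A_{2,α}` is left-symmetric. -/
theorem A2_leftSymmetric (α : ℂ) :
    ∀ a b c : Fin 4 → ℂ,
      mul2 α (mul2 α a b) c - mul2 α a (mul2 α b c) =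
      mul2 α (mul2 α b a) c - mul2 α b (mul2 α a c) := by
  intro a b c
  ext i
  fin_cases i <;>
    simp [mul2, L2, Fin.sum_univ_four, Matrix.mulVec, dotProduct] <;> ring
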